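/- arXiv:1910.04086 — 5 statements merged into one kernel-verified Lean document; each statement's English description precedes it below -/
import Mathlib

section
/- Let X be a set and k_in a positive definite kernel on X satisfying condition (i). Then d_E, defined by d_E(S,S') = sqrt(k_0(S,S) + k_0(S',S') − 2·k_0(S,S')) where k_0 is the double sum kernel of k_in, is a metric on S_fin(X); in particular d_E(S,S') > 0 whenever S ≠ S' are nonempty finite subsets of X. -/
open scoped BigOperators

/-- The double sum kernel associated with a kernel `kin` on `X`, defined on finite subsets. -/
noncomputable def doubleSumKernel {X : Type*} (kin : X → X → ℝ) (S S' : Finset X) : ℝ :=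
  (1 / ((S.card : ℝ) * (S'.card : ℝ))) * ∑ x ∈ S, ∑ x' ∈ S', kin x x'

/-- The canonical distance associated with the double sum kernel. -/
noncomputable def dE {X : Type*} (kin : X → X → ℝ) (S S' : Finset X) : ℝ :=
  Real.sqrt (doubleSumKernel kin S S + doubleSumKernel kin S' S'
    - 2 * doubleSumKernel kin S S')

/-- Condition (i): for all `n₁, n₂ ≥ 1`, `ℓ ≤ min n₁ n₂` with `n := n₁ + n₂ - ℓ ≥ 2` and not
`(ℓ = n₁ ∧ ℓ = n₂)`, and all pairwise distinct `x₁, …, xₙ`, the corresponding quadratic form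
with coefficients `1/n₁`, `1/n₁ - 1/n₂`, `-1/n₂` is positive. -/
def CondI {X : Type*} (kin : X → X → ℝ) : Prop :=
  ∀ (n₁ n₂ ℓ : ℕ), 1 ≤ n₁ → 1 ≤ n₂ → ℓ ≤ min n₁ n₂ →
    2 ≤ n₁ + n₂ - ℓ → ¬(ℓ = n₁ ∧ ℓ = n₂) →
    ∀ (x : Fin (n₁ + n₂ - ℓ) → X), Function.Injective x →
      0 < ∑ i : Fin (n₁ + n₂ - ℓ), ∑ j : Fin (n₁ + n₂ - ℓ),
        (if (i : ℕ) < n₁ - ℓ then (1 : ℝ) / (n₁ : ℝ)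
          else if (i : ℕ) < n₁ then 1 / (n₁ : ℝ) - 1 / (n₂ : ℝ) else -(1 / (n₂ : ℝ))) *
        (if (j : ℕ) < n₁ - ℓ then (1 : ℝ) / (n₁ : ℝ)
          else if (j : ℕ) < n₁ then 1 / (n₁ : ℝ) - 1 / (n₂ : ℝ) else -(1 / (n₂ : ℝ))) *
        kin (x i) (x j)

/-- The bilinear form on finitely supported functions induced by a kernel. -/
noncomputable def kernelForm {X : Type*} (k : X → X → ℝ) :
    LinearMap.BilinForm ℝ (X →₀ ℝ) :=
  Finsupp.linearCombination ℝ fun x => Finsupp.linearCombination ℝ (k x)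

/-- The uniform weight on a finite set, as a finitely supported function. -/
noncomputable def uniformWeight {X : Type*} (S : Finset X) : X →₀ ℝ :=
  (1 / (S.card : ℝ)) • ∑ x ∈ S, Finsupp.single x 1

theorem kernelForm_sum_single {X ι : Type*} [Fintype ι] (k : X → X → ℝ) (x : ι → X) (a : ι → ℝ) :
    kernelForm k (∑ i, Finsupp.single (x i) (a i)) (∑ i, Finsupp.single (x i) (a i)) =
      ∑ i, ∑ j, a i * a j * k (x i) (x j) := by
  simp only [kernelForm, map_sum, LinearMap.sum_apply, Finsupp.linearCombination_single,
    LinearMap.smul_apply, smul_eq_mul]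
  rw [Finset.sum_comm]
  exact Finset.sum_congr rfl fun i _ => Finset.sum_congr rfl fun j _ => by ring

theorem uniformWeight_apply {X : Type*} [DecidableEq X] (S : Finset X) (x : X) :
    uniformWeight S x = if x ∈ S then 1 / (S.card : ℝ) else 0 := by
  simp [uniformWeight, Finsupp.single_apply]

theorem kernelForm_uniformWeight {X : Type*} (k : X → X → ℝ) (S S' : Finset X) :
    kernelForm k (uniformWeight S) (uniformWeight S') = doubleSumKernel k S S' := by
  simp only [kernelForm, uniformWeight, doubleSumKernel, map_sum, map_smul, LinearMap.sum_apply,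
    LinearMap.smul_apply, Finsupp.linearCombination_single, one_mul, smul_eq_mul]
  rw [Finset.sum_comm, ← Finset.mul_sum, ← mul_assoc]
  congr 1
  ring

theorem kernelForm_comm {X : Type*} {k : X → X → ℝ} (hk : ∀ x y, k x y = k y x)
    (f g : X →₀ ℝ) : kernelForm k f g = kernelForm k g f := by
  have h : kernelForm k = (kernelForm k).flip := by
    ext x y
    simp [kernelForm, hk x y]
  exact DFunLike.congr_fun (DFunLike.congr_fun h f) g

theorem kernelForm_self_nonneg {X : Type*} {k : X → X → ℝ}
    (hpd : ∀ (n : ℕ) (t : Fin n → X) (a : Fin n → ℝ),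
      0 ≤ ∑ i, ∑ j, a i * a j * k (t i) (t j)) (f : X →₀ ℝ) : 0 ≤ kernelForm k f f := by
  have hf : f = ∑ i, Finsupp.single (f.support.equivFin.symm i : X)
      (f (f.support.equivFin.symm i)) := by
    rw [f.support.equivFin.symm.sum_comp (fun x => Finsupp.single (x : X) (f x)),
      Finset.sum_coe_sort f.support (fun x => Finsupp.single x (f x))]
    exact f.sum_single.symm
  rw [hf, kernelForm_sum_single]
  exact hpd _ _ _

theorem doubleSumKernel_sub_eq {X : Type*} {k : X → X → ℝ} (hk : ∀ x y, k x y = k y x)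
    (S S' : Finset X) :
    doubleSumKernel k S S + doubleSumKernel k S' S' - 2 * doubleSumKernel k S S' =
      kernelForm k (uniformWeight S - uniformWeight S') (uniformWeight S - uniformWeight S') := by
  simp only [← kernelForm_uniformWeight, map_sub, LinearMap.sub_apply]
  rw [kernelForm_comm hk (uniformWeight S') (uniformWeight S)]
  ring

theorem LinearMap.BilinForm.sqrt_apply_add_le {V : Type*} [AddCommGroup V] [Module ℝ V]
    (B : LinearMap.BilinForm ℝ V) (hB : ∀ v, 0 ≤ B v v) (hs : LinearMap.IsSymm B) (u v : V) :
    √(B (u + v) (u + v)) ≤ √(B u u) + √(B v v) := by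
  have hc : B u v ≤ √(B u u) * √(B v v) := by
    rw [← Real.sqrt_mul (hB u)]
    exact Real.le_sqrt_of_sq_le (B.apply_sq_le_of_symm hB hs u v)
  have huv : B v u = B u v := hs.eq v u
  rw [Real.sqrt_le_left (by positivity), add_sq, Real.sq_sqrt (hB u), Real.sq_sqrt (hB v)]
  simp only [map_add, LinearMap.add_apply]
  linarith

/-- Two finite sets can be jointly enumerated without repetition, listing first the points of
`S \ S'`, then those of `S ∩ S'`, and finally those of `S' \ S`. -/
theorem Finset.exists_joint_enumeration {X : Type*} [DecidableEq X] (S S' : Finset X) :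
    ∃ x : Fin (S.card + S'.card - (S ∩ S').card) → X, Function.Injective x ∧
      Finset.univ.image x = S ∪ S' ∧
      ∀ i, (x i ∈ S ↔ (i : ℕ) < S.card) ∧
        (x i ∈ S' ↔ ¬ (i : ℕ) < S.card - (S ∩ S').card) := by
  have hS : (S \ S').card = S.card - (S ∩ S').card := by
    rw [Finset.card_sdiff, Finset.inter_comm]
  have hS' := Finset.card_sdiff_add_card_inter S' S
  rw [Finset.inter_comm] at hS'
  have hle : (S ∩ S').card ≤ S.card := Finset.card_le_card Finset.inter_subset_left
  let L : List X := (S \ S').toList ++ ((S ∩ S').toList ++ (S' \ S).toList)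
  have hlen : L.length = S.card + S'.card - (S ∩ S').card := by
    simp only [L, List.length_append, Finset.length_toList]
    omega
  have hnd : L.Nodup := by
    simp only [L, List.nodup_append', Finset.nodup_toList, true_and, List.disjoint_left,
      List.mem_append, Finset.mem_toList, Finset.mem_sdiff, Finset.mem_inter]
    tauto
  have hinj : Function.Injective fun i : Fin (S.card + S'.card - (S ∩ S').card) =>
      L[(i : ℕ)]'(i.2.trans_eq hlen.symm) := fun i j hij => Fin.ext ((hnd.getElem_inj_iff).1 hij)
  refine ⟨_, hinj, ?_, fun i => ?_⟩
  · refine Finset.eq_of_subset_of_card_le (fun y hy => ?_) ?_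
    · obtain ⟨i, -, rfl⟩ := Finset.mem_image.1 hy
      have h := List.getElem_mem (l := L) (i.2.trans_eq hlen.symm)
      simp only [L, List.mem_append, Finset.mem_toList, Finset.mem_sdiff, Finset.mem_inter] at h
      rw [Finset.mem_union]
      tauto
    · rw [Finset.card_image_of_injective _ hinj, Finset.card_fin, Finset.card_union]
  · have hi := i.2
    by_cases h₁ : (i : ℕ) < (S \ S').card
    · have h : L[(i : ℕ)]'(i.2.trans_eq hlen.symm) ∈ S \ S' := by
        rw [← Finset.mem_toList, List.getElem_append_left (by simpa using h₁)]
        exact List.getElem_mem _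
      rw [Finset.mem_sdiff] at h
      simp only [h, true_iff, false_iff, not_not]
      omega
    by_cases h₂ : (i : ℕ) < S.card
    · have h : L[(i : ℕ)]'(i.2.trans_eq hlen.symm) ∈ S ∩ S' := by
        rw [← Finset.mem_toList, List.getElem_append_right (by simpa using h₁),
          List.getElem_append_left (by simp only [Finset.length_toList]; omega)]
        exact List.getElem_mem _
      rw [Finset.mem_inter] at h
      simp only [h, true_iff]
      omega
    · have h : L[(i : ℕ)]'(i.2.trans_eq hlen.symm) ∈ S' \ S := by
        rw [← Finset.mem_toList, List.getElem_append_right (by simpa using h₁),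
          List.getElem_append_right (by simp only [Finset.length_toList]; omega)]
        exact List.getElem_mem _
      rw [Finset.mem_sdiff] at h
      simp only [h, true_iff, false_iff]
      omega

theorem CondI.kernelForm_pos {X : Type*} {k : X → X → ℝ} (hk : CondI k) {S S' : Finset X}
    (hS : S.Nonempty) (hS' : S'.Nonempty) (hne : S ≠ S') :
    0 < kernelForm k (uniformWeight S - uniformWeight S')
      (uniformWeight S - uniformWeight S') := by
  classical
  obtain ⟨x, hinj, himg, hx⟩ := Finset.exists_joint_enumeration S S'
  have hle : (S ∩ S').card ≤ S.card := Finset.card_le_card Finset.inter_subset_left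
  have hle' : (S ∩ S').card ≤ S'.card := Finset.card_le_card Finset.inter_subset_right
  have hnot : ¬((S ∩ S').card = S.card ∧ (S ∩ S').card = S'.card) := fun ⟨h, h'⟩ =>
    hne ((Finset.eq_of_subset_of_card_le Finset.inter_subset_left h.ge).symm.trans
      (Finset.eq_of_subset_of_card_le Finset.inter_subset_right h'.ge))
  have hpos := hS.card_pos
  have hpos' := hS'.card_pos
  have key := hk S.card S'.card (S ∩ S').card hpos hpos' (le_min hle hle') (by omega) hnot x hinj
  have hsum : uniformWeight S - uniformWeight S' =
      ∑ i, Finsupp.single (x i) ((uniformWeight S - uniformWeight S') (x i)) := by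
    rw [← Finset.sum_image (f := fun y => Finsupp.single y
      ((uniformWeight S - uniformWeight S') y)) hinj.injOn, himg]
    ext y
    simp only [Finsupp.finsetSum_apply, Finsupp.single_apply, Finset.sum_ite_eq',
      Finset.mem_union, Finsupp.sub_apply, uniformWeight_apply]
    by_cases h : y ∈ S <;> by_cases h' : y ∈ S' <;> simp [h, h']
  have hcoeff : ∀ i, (uniformWeight S - uniformWeight S') (x i) =
      if (i : ℕ) < S.card - (S ∩ S').card then (1 : ℝ) / (S.card : ℝ)
        else if (i : ℕ) < S.card then 1 / (S.card : ℝ) - 1 / (S'.card : ℝ)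
        else -(1 / (S'.card : ℝ)) := by
    intro i
    simp only [Finsupp.sub_apply, uniformWeight_apply, (hx i).1, (hx i).2]
    split_ifs <;> first | omega | simp
  rw [hsum, kernelForm_sum_single]
  simpa only [hcoeff] using key

/-- if the positive definite kernel `kin` satisfies condition (i), then `dE` is a
metric on the nonempty finite subsets of `X`; in particular `dE S S' > 0` for `S ≠ S'`. -/
theorem dE_metric_of_condI {X : Type*} (kin : X → X → ℝ)
    (hsymm : ∀ x y : X, kin x y = kin y x)
    (hpd : ∀ (n : ℕ) (t : Fin n → X) (a : Fin n → ℝ),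
      0 ≤ ∑ i, ∑ j, a i * a j * kin (t i) (t j))
    (hcond : CondI kin) :
    (∀ S S' : Finset X, S.Nonempty → S'.Nonempty →
      0 ≤ doubleSumKernel kin S S + doubleSumKernel kin S' S'
        - 2 * doubleSumKernel kin S S') ∧
    (∀ S : Finset X, S.Nonempty → dE kin S S = 0) ∧
    (∀ S S' : Finset X, S.Nonempty → S'.Nonempty → dE kin S S' = dE kin S' S) ∧
    (∀ S S' S'' : Finset X, S.Nonempty → S'.Nonempty → S''.Nonempty →
      dE kin S S'' ≤ dE kin S S' + dE kin S' S'') ∧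
    (∀ S S' : Finset X, S.Nonempty → S'.Nonempty → S ≠ S' → 0 < dE kin S S') := by
  have hnonneg := kernelForm_self_nonneg hpd
  have hdE (S S' : Finset X) : dE kin S S' = √(kernelForm kin
      (uniformWeight S - uniformWeight S') (uniformWeight S - uniformWeight S')) :=
    congrArg Real.sqrt (doubleSumKernel_sub_eq hsymm S S')
  refine ⟨fun S S' _ _ => ?_, fun S _ => ?_, fun S S' _ _ => ?_, fun S S' S'' _ _ _ => ?_,
    fun S S' hS hS' hne => ?_⟩
  · rw [doubleSumKernel_sub_eq hsymm]
    exact hnonneg _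
  · simp [hdE]
  · rw [hdE, hdE, ← neg_sub (uniformWeight S')]
    simp only [map_neg, LinearMap.neg_apply, neg_neg]
  · rw [hdE, hdE, hdE, ← sub_add_sub_cancel (uniformWeight S) (uniformWeight S')]
    exact (kernelForm kin).sqrt_apply_add_le hnonneg ⟨kernelForm_comm hsymm⟩ _ _
  · rw [hdE]
    exact Real.sqrt_pos.2 (hcond.kernelForm_pos hS hS' hne)
end

section
/- Let X be a set, H a real inner product space, and Φ : X → H with k_in(x,x') = ⟪Φ(x), Φ(x')⟫ for all x, x' ∈ X. Define the mean embedding E(S) = (1/#S) ∑_{x∈S} Φ(x) for S ∈ S_fin(X). Then k_in satisfies condition (i) if and only if E is injective on S_fin(X). -/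
open scoped BigOperators RealInnerProductSpace

/-- The mean embedding of a finite subset given a feature map `Φ`. -/
noncomputable def meanEmb {X H : Type*} [NormedAddCommGroup H] [InnerProductSpace ℝ H]
    (Φ : X → H) (S : Finset X) : H :=
  ((S.card : ℝ))⁻¹ • ∑ x ∈ S, Φ x

/-- The coefficients of condition (i). -/
noncomputable def condICoeff (n₁ n₂ ℓ i : ℕ) : ℝ :=
  if i < n₁ - ℓ then (1 : ℝ) / (n₁ : ℝ)
  else if i < n₁ then 1 / (n₁ : ℝ) - 1 / (n₂ : ℝ) else -(1 / (n₂ : ℝ))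

theorem condICoeff_eq_sub (n₁ n₂ ℓ i : ℕ) :
    condICoeff n₁ n₂ ℓ i =
      (if i < n₁ then (n₁ : ℝ)⁻¹ else 0) - (if n₁ - ℓ ≤ i then (n₂ : ℝ)⁻¹ else 0) := by
  unfold condICoeff
  split_ifs <;> first | omega | simp

theorem sum_condICoeff_smul {X H : Type*} [NormedAddCommGroup H] [InnerProductSpace ℝ H]
    (Φ : X → H) {n₁ n₂ ℓ N : ℕ} (x : Fin N ↪ X) {S S' : Finset X}
    (hS : S = (Finset.univ.filter fun i : Fin N => (i : ℕ) < n₁).map x)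
    (hS' : S' = (Finset.univ.filter fun i : Fin N => n₁ - ℓ ≤ (i : ℕ)).map x)
    (h₁ : S.card = n₁) (h₂ : S'.card = n₂) :
    ∑ i : Fin N, condICoeff n₁ n₂ ℓ i • Φ (x i) = meanEmb Φ S - meanEmb Φ S' := by
  unfold meanEmb
  rw [h₁, h₂, hS, hS', Finset.sum_map, Finset.sum_map]
  simp only [condICoeff_eq_sub, sub_smul, Finset.sum_sub_distrib, ite_smul, zero_smul,
    Finset.sum_ite, Finset.sum_const_zero, add_zero, Finset.smul_sum]

theorem sum_sum_mul_inner {H ι : Type*} [NormedAddCommGroup H] [InnerProductSpace ℝ H]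
    [Fintype ι] (a : ι → ℝ) (v : ι → H) :
    ∑ i, ∑ j, a i * a j * ⟪v i, v j⟫ = ‖∑ i, a i • v i‖ ^ 2 := by
  rw [← real_inner_self_eq_norm_sq, sum_inner]
  refine Finset.sum_congr rfl fun i _ => ?_
  rw [inner_sum]
  refine Finset.sum_congr rfl fun j _ => ?_
  rw [real_inner_smul_left, real_inner_smul_right, mul_assoc]

/-- Condition (i) says that the weighted sums of feature vectors do not vanish. -/
theorem condI_iff_sum_ne_zero {X H : Type*} [NormedAddCommGroup H] [InnerProductSpace ℝ H]
    (Φ : X → H) (kin : X → X → ℝ) (hfeat : ∀ x x' : X, kin x x' = ⟪Φ x, Φ x'⟫) :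
    CondI kin ↔ ∀ n₁ n₂ ℓ : ℕ, 1 ≤ n₁ → 1 ≤ n₂ → ℓ ≤ min n₁ n₂ →
      2 ≤ n₁ + n₂ - ℓ → ¬(ℓ = n₁ ∧ ℓ = n₂) → ∀ x : Fin (n₁ + n₂ - ℓ) → X,
        Function.Injective x →
          ∑ i : Fin (n₁ + n₂ - ℓ), condICoeff n₁ n₂ ℓ i • Φ (x i) ≠ 0 := by
  unfold CondI
  refine forall₃_congr fun n₁ n₂ ℓ => forall₅_congr fun _ _ _ _ _ => forall₂_congr fun x _ => ?_
  have h := sum_sum_mul_inner (fun i : Fin (n₁ + n₂ - ℓ) => condICoeff n₁ n₂ ℓ i)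
    (fun i => Φ (x i))
  simp only [← hfeat] at h
  simp only [condICoeff] at h ⊢
  rw [h, sq_pos_iff, norm_ne_zero_iff]

/-- The union of two finite sets can be enumerated so that the first set is an initial segment
and the second one a final segment. -/
theorem exists_embedding_map_filter_eq {X : Type*} [DecidableEq X] (S S' : Finset X) :
    ∃ x : Fin (S.card + S'.card - (S ∩ S').card) ↪ X,
      S = (Finset.univ.filter fun i : Fin (S.card + S'.card - (S ∩ S').card) =>
        (i : ℕ) < S.card).map x ∧
      S' = (Finset.univ.filter fun i : Fin (S.card + S'.card - (S ∩ S').card) =>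
        S.card - (S ∩ S').card ≤ (i : ℕ)).map x := by
  have hab : (S \ S').card + (S ∩ S').card = S.card := Finset.card_sdiff_add_card_inter S S'
  have hbc : (S' \ S).card + (S ∩ S').card = S'.card := by
    rw [Finset.inter_comm]; exact Finset.card_sdiff_add_card_inter S' S
  set A := (S \ S').toList with hA
  set B := (S ∩ S').toList with hB
  set C := (S' \ S).toList with hC
  have hlA : A.length = (S \ S').card := Finset.length_toList _
  have hlB : B.length = (S ∩ S').card := Finset.length_toList _
  have hlC : C.length = (S' \ S).card := Finset.length_toList _
  have hlen : S.card + S'.card - (S ∩ S').card = (A ++ B ++ C).length := by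
    simp only [List.length_append]; omega
  have hnodup : (A ++ B ++ C).Nodup := by
    simp only [List.nodup_append, hA, hB, hC, Finset.nodup_toList, Finset.mem_toList,
      List.mem_append, Finset.mem_sdiff, Finset.mem_inter, true_and]
    refine ⟨?_, ?_⟩
    · rintro a ⟨_, h⟩ b ⟨_, h'⟩ rfl
      exact h h'
    · rintro a h b ⟨_, h'⟩ rfl
      tauto
  have htake : (A ++ B ++ C).take S.card = A ++ B := by
    apply List.take_left'
    simp only [List.length_append]; omega
  have hdrop : (A ++ B ++ C).drop (S.card - (S ∩ S').card) = B ++ C := by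
    rw [List.append_assoc]
    apply List.drop_left'
    omega
  refine ⟨⟨fun i => (A ++ B ++ C).get (Fin.cast hlen i),
    hnodup.injective_get.comp (Fin.cast_injective hlen)⟩, ?_, ?_⟩
  · ext y
    have hy : y ∈ S ↔ y ∈ (A ++ B ++ C).take S.card := by
      rw [htake]
      simp only [hA, hB, List.mem_append, Finset.mem_toList, Finset.mem_sdiff, Finset.mem_inter]
      tauto
    rw [hy, List.mem_take_iff_getElem]
    simp only [Finset.mem_map, Finset.mem_filter, Finset.mem_univ, true_and,
      Function.Embedding.coeFn_mk, List.get_eq_getElem, Fin.val_cast]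
    constructor
    · rintro ⟨i, hi, rfl⟩
      exact ⟨⟨i, by omega⟩, by simp only; omega, rfl⟩
    · rintro ⟨i, hi, rfl⟩
      exact ⟨i, by omega, rfl⟩
  · ext y
    have hy : y ∈ S' ↔ y ∈ (A ++ B ++ C).drop (S.card - (S ∩ S').card) := by
      rw [hdrop]
      simp only [hC, hB, List.mem_append, Finset.mem_toList, Finset.mem_sdiff, Finset.mem_inter]
      tauto
    rw [hy, List.mem_drop_iff_getElem]
    simp only [Finset.mem_map, Finset.mem_filter, Finset.mem_univ, true_and,
      Function.Embedding.coeFn_mk, List.get_eq_getElem, Fin.val_cast]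
    constructor
    · rintro ⟨i, hi, rfl⟩
      exact ⟨⟨S.card - (S ∩ S').card + i, by omega⟩, by simp only; omega, rfl⟩
    · rintro ⟨i, hi, rfl⟩
      refine ⟨i - (S.card - (S ∩ S').card), by omega, ?_⟩
      congr 1
      omega

/-- if `Φ` is a feature map for `kin`, then `kin` satisfies condition (i) if and
only if the mean embedding is injective on nonempty finite subsets of `X`. -/
theorem condI_iff_meanEmb_injective {X H : Type*}
    [NormedAddCommGroup H] [InnerProductSpace ℝ H]
    (Φ : X → H) (kin : X → X → ℝ)
    (hfeat : ∀ x x' : X, kin x x' = ⟪Φ x, Φ x'⟫) :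
    CondI kin ↔
      (∀ S S' : Finset X, S.Nonempty → S'.Nonempty →
        meanEmb Φ S = meanEmb Φ S' → S = S') := by
  classical
  rw [condI_iff_sum_ne_zero Φ kin hfeat]
  constructor
  · intro h S S' hS hS' hE
    by_contra hne
    obtain ⟨x, hx, hx'⟩ := exists_embedding_map_filter_eq S S'
    have hl₁ : (S ∩ S').card ≤ S.card := Finset.card_le_card Finset.inter_subset_left
    have hl₂ : (S ∩ S').card ≤ S'.card := Finset.card_le_card Finset.inter_subset_right
    have hcard : ¬((S ∩ S').card = S.card ∧ (S ∩ S').card = S'.card) := by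
      rintro ⟨h₁, h₂⟩
      exact hne ((Finset.eq_of_subset_of_card_le Finset.inter_subset_left h₁.ge).symm.trans
        (Finset.eq_of_subset_of_card_le Finset.inter_subset_right h₂.ge))
    have hpos := hS.card_pos
    have hpos' := hS'.card_pos
    refine h S.card S'.card (S ∩ S').card hpos hpos' (le_min hl₁ hl₂) (by omega) hcard x
      x.injective ?_
    rw [sum_condICoeff_smul Φ x hx hx' rfl rfl, hE, sub_self]
  · intro h n₁ n₂ ℓ hn₁ hn₂ hl _ hne x hx hsum
    have hl₁ : ℓ ≤ n₁ := hl.trans (min_le_left _ _)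
    have hl₂ : ℓ ≤ n₂ := hl.trans (min_le_right _ _)
    let e : Fin (n₁ + n₂ - ℓ) ↪ X := ⟨x, hx⟩
    let I : Finset (Fin (n₁ + n₂ - ℓ)) := Finset.univ.filter fun i => (i : ℕ) < n₁
    let J : Finset (Fin (n₁ + n₂ - ℓ)) := Finset.univ.filter fun i => n₁ - ℓ ≤ (i : ℕ)
    have hI : (I.map e).card = n₁ := by
      rw [Finset.card_map, Fin.card_filter_val_lt]
      omega
    have hJ : (J.map e).card = n₂ := by
      have := Finset.card_filter_add_card_filter_not (s := Finset.univ)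
        (fun i : Fin (n₁ + n₂ - ℓ) => (i : ℕ) < n₁ - ℓ)
      simp only [not_lt, Fin.card_filter_val_lt, Finset.card_univ, Fintype.card_fin] at this
      simp only [Finset.card_map, J]
      omega
    have hIJ : I = J := by
      refine Finset.map_injective e (h _ _ (Finset.card_pos.1 (by omega))
        (Finset.card_pos.1 (by omega)) (sub_eq_zero.1 ?_))
      rw [← sum_condICoeff_smul Φ e rfl rfl hI hJ]
      exact hsum
    have hmem : ∀ i (hi : i < n₁ + n₂ - ℓ), i < n₁ ↔ n₁ - ℓ ≤ i := fun i hi => by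
      simpa [I, J] using Finset.ext_iff.1 hIJ ⟨i, hi⟩
    have hfirst := hmem 0 (by omega)
    have hlast := hmem (n₁ + n₂ - ℓ - 1) (by omega)
    omega
end

section
/- Let X be a set containing two distinct elements x_A ≠ x_B, and let k_in be any kernel on X. Set S_1 = {x_A}, S_2 = {x_B}, S_3 = {x_A, x_B}, and let G be the 3×3 matrix with entries G_{ij} = k_0(S_i,S_j), where k_0 is the double sum kernel of k_in. Then det G = 0; in particular G is not invertible. -/
open scoped BigOperators

/-- for any kernel `kin` on a set with two distinct elements `x_A ≠ x_B`, the
3×3 Gram matrix of the double sum kernel at `{x_A}`, `{x_B}`, `{x_A, x_B}` has determinant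
zero; in particular it is not invertible. -/
theorem doubleSumKernel_gram_det_eq_zero {X : Type*} [DecidableEq X] (kin : X → X → ℝ)
    (xA xB : X) (hAB : xA ≠ xB) :
    (Matrix.of fun i j : Fin 3 =>
        doubleSumKernel kin
          (![({xA} : Finset X), {xB}, {xA, xB}] i)
          (![({xA} : Finset X), {xB}, {xA, xB}] j)).det = 0 ∧
    ¬ IsUnit (Matrix.of fun i j : Fin 3 =>
        doubleSumKernel kin
          (![({xA} : Finset X), {xB}, {xA, xB}] i)
          (![({xA} : Finset X), {xB}, {xA, xB}] j)) := by
  have hdet : (Matrix.of fun i j : Fin 3 =>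
      doubleSumKernel kin
        (![({xA} : Finset X), {xB}, {xA, xB}] i)
        (![({xA} : Finset X), {xB}, {xA, xB}] j)).det = 0 := by
    simp [Matrix.det_fin_three, doubleSumKernel, Finset.sum_pair hAB, Finset.card_pair hAB]
    ring
  refine ⟨hdet, fun hunit => ?_⟩
  rw [Matrix.isUnit_iff_isUnit_det, hdet] at hunit
  exact not_isUnit_zero hunit
end

section
/- Let X be a set with at least two elements and k_in a positive definite kernel on X. Then the double sum kernel k_0 is not strictly positive definite on S_fin(X): there exist pairwise distinct nonempty finite subsets S_1, S_2, S_3 of X and (a_1,a_2,a_3) ∈ ℝ³ with (a_1,a_2,a_3) ≠ (0,0,0) such that ∑_{i=1}^3 ∑_{j=1}^3 a_i a_j k_0(S_i,S_j) = 0. -/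
open scoped BigOperators

/-- on a set with at least two elements, the double sum kernel of any positive
definite kernel `kin` is not strictly positive definite: there are pairwise distinct nonempty
finite subsets `S₁, S₂, S₃` and a nonzero coefficient vector whose quadratic form vanishes. -/
theorem doubleSumKernel_not_strictPosDef {X : Type*} [Nontrivial X] (kin : X → X → ℝ)
    (hsymm : ∀ x y : X, kin x y = kin y x)
    (hpd : ∀ (n : ℕ) (t : Fin n → X) (a : Fin n → ℝ),
      0 ≤ ∑ i, ∑ j, a i * a j * kin (t i) (t j)) :
    ∃ (S : Fin 3 → Finset X) (a : Fin 3 → ℝ),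
      (∀ i, (S i).Nonempty) ∧ Function.Injective S ∧ a ≠ 0 ∧
      ∑ i, ∑ j, a i * a j * doubleSumKernel kin (S i) (S j) = 0 := by
  classical
  obtain ⟨x, y, hxy⟩ := exists_pair_ne X
  refine ⟨![{x}, {y}, {x, y}], ![1, 1, -2], ?_, ?_, ?_, ?_⟩
  · intro i
    fin_cases i <;> simp
  · have hx : ({x} : Finset X) ≠ {x, y} := fun h => hxy (by
      have : y ∈ ({x} : Finset X) := h ▸ by simp
      exact (Finset.mem_singleton.mp this).symm)
    have hy : ({y} : Finset X) ≠ {x, y} := fun h => hxy (by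
      have : x ∈ ({y} : Finset X) := h ▸ by simp
      exact Finset.mem_singleton.mp this)
    have hs : ({x} : Finset X) ≠ {y} := fun h => hxy (Finset.singleton_injective h)
    intro i j hij
    fin_cases i <;> fin_cases j <;> first | rfl | exact absurd hij ‹_› | exact absurd hij.symm ‹_›
  · intro h
    simpa using congrFun h 0
  · simp [Fin.sum_univ_three, doubleSumKernel, Finset.sum_pair hxy, Finset.card_pair hxy]
    ring
end

section
/- Let X be a finite set of cardinality c ≥ 1 and k_in a kernel on X. Then for every integer q > c and every choice of nonempty subsets S_1,…,S_q of X, the q×q Gram matrix with entries k_0(S_i,S_j), where k_0 is the double sum kernel of k_in, is singular: its determinant equals 0. -/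
open scoped BigOperators

open Classical in
/-- The matrix whose `i`-th row is the uniform probability vector on `S i`. -/
noncomputable def uniformWeightMatrix {ι X : Type*} (S : ι → Finset X) : Matrix ι X ℝ :=
  Matrix.of fun i x => if x ∈ S i then ((S i).card : ℝ)⁻¹ else 0

/-- The Gram matrix of the double sum kernel factors through the Gram matrix of `kin`. -/
theorem doubleSumKernel_gram_eq_mul {ι X : Type*} [Fintype X] (kin : X → X → ℝ)
    (S : ι → Finset X) :
    (Matrix.of fun i j : ι => doubleSumKernel kin (S i) (S j)) =
      uniformWeightMatrix S * (Matrix.of kin * (uniformWeightMatrix S).transpose) := by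
  ext i j
  simp only [uniformWeightMatrix, doubleSumKernel, Matrix.mul_apply, Matrix.of_apply,
    Matrix.transpose_apply, ite_mul, mul_ite, zero_mul, mul_zero, Finset.sum_ite_mem,
    Finset.univ_inter]
  simp only [Finset.mul_sum]
  refine Finset.sum_congr rfl fun x _ => Finset.sum_congr rfl fun y _ => ?_
  rw [one_div, mul_inv]
  ring

/-- A square matrix that factors through a smaller index type is singular. -/
theorem Matrix.det_mul_eq_zero_of_card_lt {m n K : Type*} [Fintype m] [Fintype n] [DecidableEq m]
    [Field K] (A : Matrix m n K) (B : Matrix n m K) (h : Fintype.card n < Fintype.card m) :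
    (A * B).det = 0 := by
  by_contra hdet
  have hrank := Matrix.rank_of_isUnit (A * B)
    ((Matrix.isUnit_iff_isUnit_det _).2 (isUnit_iff_ne_zero.2 hdet))
  have := (Matrix.rank_mul_le_left A B).trans A.rank_le_card_width
  omega

/-- on a finite set `X` of cardinality `c ≥ 1`, any `q × q` Gram matrix of the
double sum kernel with `q > c` is singular. -/
theorem doubleSumKernel_gram_det_eq_zero_of_card_lt {X : Type*} [Fintype X]
    (kin : X → X → ℝ) (c : ℕ) (hc : 1 ≤ c) (hcard : Fintype.card X = c)
    (q : ℕ) (hq : c < q) (S : Fin q → Finset X) (hS : ∀ i, (S i).Nonempty) :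
    (Matrix.of fun i j : Fin q => doubleSumKernel kin (S i) (S j)).det = 0 := by
  rw [doubleSumKernel_gram_eq_mul]
  exact Matrix.det_mul_eq_zero_of_card_lt _ _ (by simpa [hcard] using hq)
end
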